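/- arXiv:0808.2658 — 3 statements merged into one kernel-verified Lean document; each statement's English description precedes it below -/
import Mathlib

section
/- Let n ≥ 2 and let ρ : ℝ^{n+1} \ {0} → ℝ be a C² function that is positively homogeneous of degree 0 (ρ(λy) = ρ(y) for all λ > 0), so that for |x| = 1 the Euclidean gradient ∇ρ(x) satisfies ∇ρ(x)·x = 0. For |x| = 1 define φ(x) = (e^{ρ(x)}/2)(1 + e^{-2ρ(x)}(1 + |∇ρ(x)|²))·(1, x) + e^{-ρ(x)}·(0, -x + ∇ρ(x)) ∈ ℝ^{n+2} and η(x) = e^{ρ(x)}(1, x) - φ(x). Then for every C¹ curve c : (-ε, ε) → ℝ^{n+1} with |c(s)| = 1 for all s and c(0) = x, the curve φ∘c is differentiable at 0 and ⟨(φ∘c)'(0), η(x)⟩ = 0. In other words, η is a unit normal field of the hypersurface φ, whose associated light cone map is ψ(x) = e^{ρ(x)}(1, x) and whose hyperbolic Gauss map is G(x) = x. -/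
open scoped BigOperators

/-- The Minkowski bilinear form on `ℝ^{n+2}`:
`⟨v, w⟩ = -v₀w₀ + ∑_{i=1}^{n+1} vᵢwᵢ`. -/
noncomputable def mink {n : ℕ} (v w : Fin (n + 2) → ℝ) : ℝ :=
  -(v 0 * w 0) + ∑ i : Fin (n + 1), v i.succ * w i.succ

/-- The vector `(c, x) ∈ ℝ × ℝ^{n+1} = ℝ^{n+2}`. -/
noncomputable def pair {n : ℕ} (c : ℝ) (x : Fin (n + 1) → ℝ) : Fin (n + 2) → ℝ :=
  Fin.cons c x

/-- The representation formula
`φ(y) = (e^{ρ(y)}/2)(1 + e^{-2ρ(y)}(1 + |∇ρ(y)|²))·(1,y) + e^{-ρ(y)}·(0, -y + ∇ρ(y))`. -/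
noncomputable def phiRep (n : ℕ) (ρ : EuclideanSpace ℝ (Fin (n + 1)) → ℝ)
    (y : EuclideanSpace ℝ (Fin (n + 1))) : Fin (n + 2) → ℝ :=
  (Real.exp (ρ y) / 2 *
        (1 + Real.exp (-2 * ρ y) * (1 + ∑ i, (gradient ρ y) i ^ 2))) •
      pair 1 (fun i => y i)
    + Real.exp (-ρ y) • pair 0 (fun i => -y i + (gradient ρ y) i)

/-- The normal field `η(y) = e^{ρ(y)}(1,y) - φ(y)`. -/
noncomputable def etaRep (n : ℕ) (ρ : EuclideanSpace ℝ (Fin (n + 1)) → ℝ)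
    (y : EuclideanSpace ℝ (Fin (n + 1))) : Fin (n + 2) → ℝ :=
  Real.exp (ρ y) • pair 1 (fun i => y i) - phiRep n ρ y

theorem phiRep_zero (n : ℕ) (ρ : EuclideanSpace ℝ (Fin (n + 1)) → ℝ)
    (y : EuclideanSpace ℝ (Fin (n + 1))) :
    phiRep n ρ y 0 = Real.exp (ρ y) / 2 *
        (1 + Real.exp (-2 * ρ y) * (1 + ∑ i, (gradient ρ y) i ^ 2)) := by
  simp [phiRep, pair]

theorem phiRep_succ (n : ℕ) (ρ : EuclideanSpace ℝ (Fin (n + 1)) → ℝ)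
    (y : EuclideanSpace ℝ (Fin (n + 1))) (i : Fin (n + 1)) :
    phiRep n ρ y i.succ = phiRep n ρ y 0 * y i
      + Real.exp (-ρ y) * (-y i + (gradient ρ y) i) := by
  simp [phiRep, pair]

theorem etaRep_zero (n : ℕ) (ρ : EuclideanSpace ℝ (Fin (n + 1)) → ℝ)
    (y : EuclideanSpace ℝ (Fin (n + 1))) :
    etaRep n ρ y 0 = Real.exp (ρ y) - phiRep n ρ y 0 := by
  simp [etaRep, pair]

theorem etaRep_succ (n : ℕ) (ρ : EuclideanSpace ℝ (Fin (n + 1)) → ℝ)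
    (y : EuclideanSpace ℝ (Fin (n + 1))) (i : Fin (n + 1)) :
    etaRep n ρ y i.succ = (Real.exp (ρ y) - phiRep n ρ y 0) * y i
      - Real.exp (-ρ y) * (-y i + (gradient ρ y) i) := by
  simp only [etaRep, Pi.sub_apply, phiRep_succ, Pi.smul_apply, pair, Fin.cons_succ, smul_eq_mul]
  ring

/-- The gradient of a function of class `C²` on an open set is differentiable there. -/
theorem ContDiffOn.differentiableAt_gradient {E : Type*} [NormedAddCommGroup E]
    [InnerProductSpace ℝ E] [CompleteSpace E] {f : E → ℝ} {s : Set E}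
    (hf : ContDiffOn ℝ 2 f s) (hs : IsOpen s) {y : E} (hy : y ∈ s) :
    DifferentiableAt ℝ (gradient f) y := by
  have h : DifferentiableAt ℝ (fderiv ℝ f) y :=
    ((hf.fderiv_of_isOpen (m := 1) hs (by norm_num)).differentiableOn (by norm_num)).differentiableAt
      (hs.mem_nhds hy)
  exact (InnerProductSpace.toDual ℝ E).symm.differentiable.differentiableAt.comp y h

/-- Euler's identity in degree `0`: the gradient of a positively `0`-homogeneous function is
orthogonal to the position vector. -/
theorem inner_gradient_self_eq_zero {E : Type*} [NormedAddCommGroup E]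
    [InnerProductSpace ℝ E] [CompleteSpace E] {f : E → ℝ} {y : E}
    (hf : DifferentiableAt ℝ f y) (hhom : ∀ l : ℝ, 0 < l → f (l • y) = f y) :
    inner ℝ (gradient f y) y = 0 := by
  have h1 : HasDerivAt (fun l : ℝ => l • y) y 1 := by
    simpa using (hasDerivAt_id (1 : ℝ)).smul_const y
  have h2 : HasDerivAt (fun l : ℝ => f (l • y)) (fderiv ℝ f y y) 1 := by
    refine HasFDerivAt.comp_hasDerivAt (1 : ℝ) ?_ h1
    simpa using hf.hasFDerivAt
  have h3 : HasDerivAt (fun l : ℝ => f (l • y)) 0 1 :=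
    (hasDerivAt_const (1 : ℝ) (f y)).congr_of_eventuallyEq <| by
      filter_upwards [lt_mem_nhds (zero_lt_one' ℝ)] with l hl using hhom l hl
  rw [gradient, InnerProductSpace.toDual_symm_apply]
  exact h2.unique h3

/-- if `ρ` is a C² function on `ℝ^{n+1} \ {0}` which is positively
homogeneous of degree 0, then for `|x| = 1` the gradient `∇ρ(x)` is tangent to
the sphere, and for every C¹ curve `c` on the unit sphere through `x`, the curve
`φ ∘ c` is differentiable at `0` with velocity Minkowski-orthogonal to `η(x)`:
`η` is a unit normal field of the hypersurface `φ`. -/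
theorem eta_is_normal_field
    (n : ℕ) (hn : 2 ≤ n) (ρ : EuclideanSpace ℝ (Fin (n + 1)) → ℝ)
    (hρ : ContDiffOn ℝ 2 ρ {0}ᶜ)
    (hhom : ∀ l : ℝ, 0 < l → ∀ y : EuclideanSpace ℝ (Fin (n + 1)), ρ (l • y) = ρ y)
    (x : EuclideanSpace ℝ (Fin (n + 1))) (hx : ‖x‖ = 1) :
    (∑ i, (gradient ρ x) i * x i = 0) ∧
    ∀ (ε : ℝ), 0 < ε → ∀ c : ℝ → EuclideanSpace ℝ (Fin (n + 1)),
      ContDiffOn ℝ 1 c (Set.Ioo (-ε) ε) →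
      (∀ s ∈ Set.Ioo (-ε) ε, ‖c s‖ = 1) → c 0 = x →
      DifferentiableAt ℝ (fun s => phiRep n ρ (c s)) 0 ∧
        mink (deriv (fun s => phiRep n ρ (c s)) 0) (etaRep n ρ x) = 0 := by
  have hopen : IsOpen ({0}ᶜ : Set (EuclideanSpace ℝ (Fin (n + 1)))) := isOpen_compl_singleton
  have hne : ∀ y : EuclideanSpace ℝ (Fin (n + 1)), ‖y‖ = 1 →
      y ∈ ({0}ᶜ : Set (EuclideanSpace ℝ (Fin (n + 1)))) := by
    rintro y hy rfl
    simp at hy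
  have hdiff : ∀ y : EuclideanSpace ℝ (Fin (n + 1)), ‖y‖ = 1 → DifferentiableAt ℝ ρ y :=
    fun y hy => (hρ.differentiableOn (by norm_num)).differentiableAt (hopen.mem_nhds (hne y hy))
  have horth : ∀ y : EuclideanSpace ℝ (Fin (n + 1)), ‖y‖ = 1 → inner ℝ (gradient ρ y) y = 0 :=
    fun y hy => inner_gradient_self_eq_zero (hdiff y hy) fun l hl => hhom l hl y
  have hsum : ∀ u v : EuclideanSpace ℝ (Fin (n + 1)), inner ℝ u v = ∑ i, u i * v i := by
    intro u v
    simp [PiLp.inner_apply, mul_comm]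
  refine ⟨by rw [← hsum]; exact horth x hx, ?_⟩
  rintro ε hε c hc hcn rfl
  have hI : Set.Ioo (-ε) ε ∈ nhds (0 : ℝ) := Ioo_mem_nhds (by linarith) hε
  have hc' : HasDerivAt c (deriv c 0) 0 :=
    ((hc.differentiableOn (by norm_num)).differentiableAt hI).hasDerivAt
  set v := deriv c 0
  have hg : HasDerivAt (fun s => gradient ρ (c s)) (fderiv ℝ (gradient ρ) (c 0) v) 0 :=
    (hρ.differentiableAt_gradient hopen (hne _ hx)).hasFDerivAt.comp_hasDerivAt (0 : ℝ) hc'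
  set w := fderiv ℝ (gradient ρ) (c 0) v
  have hr : HasDerivAt (fun s => ρ (c s)) (inner ℝ (gradient ρ (c 0)) v) 0 := by
    rw [gradient, InnerProductSpace.toDual_symm_apply]
    exact (hdiff _ hx).hasFDerivAt.comp_hasDerivAt (0 : ℝ) hc'
  have hcc : inner ℝ (c 0) v = 0 := by
    have h1 := (hc'.inner ℝ hc').unique <|
      (hasDerivAt_const (0 : ℝ) (1 : ℝ)).congr_of_eventuallyEq <| by
        filter_upwards [hI] with s hs
        simp [hcn s hs]
    rw [real_inner_comm (c 0) v] at h1
    linarith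
  have hgc : inner ℝ (gradient ρ (c 0)) v + inner ℝ w (c 0) = 0 :=
    (hg.inner ℝ hc').unique <|
      (hasDerivAt_const (0 : ℝ) (0 : ℝ)).congr_of_eventuallyEq <| by
        filter_upwards [hI] with s hs using horth _ (hcn s hs)
  have hg2 : HasDerivAt (fun s => ∑ i, (gradient ρ (c s)) i ^ 2)
      (2 * inner ℝ (gradient ρ (c 0)) w) 0 := by
    have h1 := hg.inner ℝ hg
    rw [real_inner_comm (gradient ρ (c 0)) w, ← two_mul] at h1
    simpa only [hsum, ← sq] using h1
  have hg0 : inner ℝ (gradient ρ (c 0)) (gradient ρ (c 0)) = ∑ i, (gradient ρ (c 0)) i ^ 2 := by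
    simp only [hsum, ← sq]
  have hx1 : inner ℝ (c 0) (c 0) = (1 : ℝ) := by simp [hx]
  have hx0 := horth _ hx
  have hvi : ∀ i, HasDerivAt (fun s => c s i) (v i) 0 := fun i =>
    (EuclideanSpace.proj (𝕜 := ℝ) i).hasFDerivAt.comp_hasDerivAt (0 : ℝ) hc'
  have hwi : ∀ i, HasDerivAt (fun s => gradient ρ (c s) i) (w i) 0 := fun i =>
    (EuclideanSpace.proj (𝕜 := ℝ) i).hasFDerivAt.comp_hasDerivAt (0 : ℝ) hg
  have hA := ((hr.exp.div_const 2).mul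
    (((hr.const_mul (-2)).exp.mul (hg2.const_add 1)).const_add 1))
  have hφ0 : HasDerivAt (fun s => phiRep n ρ (c s) 0) _ 0 :=
    hA.congr_of_eventuallyEq (Filter.Eventually.of_forall fun s => phiRep_zero n ρ (c s))
  have hφi : ∀ i : Fin (n + 1), HasDerivAt (fun s => phiRep n ρ (c s) i.succ) _ 0 := fun i =>
    ((hφ0.mul (hvi i)).add (hr.neg.exp.mul ((hvi i).neg.add (hwi i)))).congr_of_eventuallyEq
      (Filter.Eventually.of_forall fun s => phiRep_succ n ρ (c s) i)
  have hd : DifferentiableAt ℝ (fun s => phiRep n ρ (c s)) 0 :=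
    differentiableAt_pi.2 fun j =>
      Fin.cases hφ0.differentiableAt (fun i => (hφi i).differentiableAt) j
  refine ⟨hd, ?_⟩
  have hcoord : ∀ j, deriv (fun s => phiRep n ρ (c s)) 0 j
      = deriv (fun s => phiRep n ρ (c s) j) 0 := fun j =>
    ((hasDerivAt_pi.1 hd.hasDerivAt) j).deriv.symm
  simp only [mink, hcoord, hφ0.deriv, (hφi _).deriv, etaRep_zero, etaRep_succ,
    Pi.neg_apply, Pi.add_apply, Pi.mul_apply]
  set a := phiRep n ρ (c 0) 0 with ha
  rw [phiRep_zero, ← hg0] at ha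
  rw [← hg0]
  set g := gradient ρ (c 0)
  set r := Real.exp (ρ (c 0))
  set q := Real.exp (-ρ (c 0)) with hq
  have hrq : r * q = 1 := by rw [hq, ← Real.exp_add]; simp
  have hq2 : Real.exp (-2 * ρ (c 0)) = q ^ 2 := by
    rw [hq, ← Real.exp_nat_mul]
    congr 1
    push_cast
    ring
  rw [hq2] at ha ⊢
  have hexpand : ∀ A : ℝ,
      ∑ i, (A * c 0 i + a * v i + (q * -inner ℝ g v * (-c 0 i + g i) + q * (-v i + w i))) *
          ((r - a) * c 0 i - q * (-c 0 i + g i))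
        = A * (r - a) - q * (-A + a * inner ℝ g v - q * inner ℝ g v * (1 + inner ℝ g g)
            + q * inner ℝ g w) := by
    intro A
    have h1 := hsum (A • c 0 + a • v + ((q * -inner ℝ g v) • (-c 0 + g) + q • (-v + w)))
      ((r - a) • c 0 - q • (-c 0 + g))
    simp only [PiLp.add_apply, PiLp.sub_apply, PiLp.neg_apply, PiLp.smul_apply, smul_eq_mul] at h1
    rw [← h1]
    simp only [inner_add_left, inner_sub_right, inner_add_right, inner_smul_left, inner_smul_right,
      inner_neg_left, inner_neg_right, real_inner_comm g v, real_inner_comm (c 0) v,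
      real_inner_comm g w, real_inner_comm g (c 0), hx1, hx0, hcc, conj_trivial,
      eq_neg_of_add_eq_zero_right hgc]
    ring
  rw [hexpand]
  linear_combination (-q ^ 2 * (inner ℝ g v * (1 + inner ℝ g g) - inner ℝ g w)) * hrq
    - q * inner ℝ g v * ha
end

section
/- Let n ≥ 1 and let T : ℝ^{n+2} → ℝ^{n+2} be a linear map satisfying ⟨Tv, Tv⟩ = ⟨v, v⟩ for all v and mapping the positive null cone ℕ₊^{n+1} into itself. For |x| = 1 define Φ(x) ∈ ℝ^{n+1} and ω(x) ∈ ℝ by T(1, x) = e^{-ω(x)}(1, Φ(x)) (this is well defined since the 0-th coordinate of T(1, x) is positive). Then for every C¹ curve c : (-ε, ε) → ℝ^{n+1} with |c(s)| = 1 for all s, c(0) = x and c'(0) = u, the curve Φ∘c is differentiable at 0 and |(Φ∘c)'(0)| = e^{ω(x)}|u|. That is, the induced map Φ of the unit sphere is conformal with conformal factor e^ω. -/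
open scoped BigOperators

theorem mink_pair_self {n : ℕ} (a : ℝ) (y : Fin (n + 1) → ℝ) :
    mink (pair a y) (pair a y) = -a ^ 2 + ∑ i, y i ^ 2 := by
  simp [mink, pair, pow_two]

/-- A normalized image of a null vector under a map preserving the Minkowski form lies on the
unit sphere. -/
theorem sum_sq_eq_one_of_map_pair_eq_smul {n : ℕ}
    {T : (Fin (n + 2) → ℝ) →ₗ[ℝ] (Fin (n + 2) → ℝ)}
    (hT : ∀ v, mink (T v) (T v) = mink v v) {a : ℝ} (ha : a ≠ 0) {y z : Fin (n + 1) → ℝ}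
    (hy : ∑ i, y i ^ 2 = 1) (h : T (pair 1 y) = a • pair 1 z) :
    ∑ i, z i ^ 2 = 1 := by
  have hnull := hT (pair 1 y)
  have hscale : a • pair 1 z = pair a (a • z) := by
    ext i
    refine Fin.cases ?_ (fun j => ?_) i <;> simp [pair]
  rw [h, hscale, mink_pair_self, mink_pair_self, hy] at hnull
  simp only [Pi.smul_apply, smul_eq_mul, mul_pow, ← Finset.mul_sum] at hnull
  have : a ^ 2 * (∑ i, z i ^ 2) = a ^ 2 * 1 := by linarith
  exact mul_left_cancel₀ (pow_ne_zero 2 ha) this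

theorem HasDerivAt.pair_one {n : ℕ} {c : ℝ → Fin (n + 1) → ℝ} {u : Fin (n + 1) → ℝ} {t : ℝ}
    (h : HasDerivAt c u t) : HasDerivAt (fun s => pair 1 (c s)) (pair 0 u) t := by
  rw [hasDerivAt_pi] at h ⊢
  refine Fin.cases ?_ (fun j => ?_)
  · simpa [pair] using hasDerivAt_const t (1 : ℝ)
  · simpa [pair] using h j

/-- A differentiable curve on the unit sphere is orthogonal to its velocity. -/
theorem HasDerivAt.sum_mul_eq_zero_of_sum_sq_eq_one {ι : Type*} [Fintype ι] {p : ℝ → ι → ℝ}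
    {v : ι → ℝ} {t : ℝ} (h : HasDerivAt p v t) (hp : ∀ᶠ s in nhds t, ∑ i, p s i ^ 2 = 1) :
    ∑ i, p t i * v i = 0 := by
  rw [hasDerivAt_pi] at h
  have hsum : HasDerivAt (fun s => ∑ i, p s i ^ 2) (∑ i, 2 * (p t i * v i)) t := by
    refine HasDerivAt.fun_sum fun i _ => ?_
    simpa [mul_assoc] using (h i).fun_pow 2
  have hzero := hsum.unique ((hasDerivAt_const t (1 : ℝ)).congr_of_eventuallyEq hp)
  rw [← Finset.mul_sum] at hzero
  linarith

/-- let `T` be a linear isometry of the Minkowski form mapping the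
positive null cone into itself, and let `Φ`, `ω` be defined on the unit sphere by
`T(1, x) = e^{-ω(x)}(1, Φ(x))`.  Then for every C¹ curve `c` on the unit sphere
with `c(0) = x` and `c'(0) = u`, the curve `Φ ∘ c` is differentiable at `0` and
`|(Φ∘c)'(0)| = e^{ω(x)}|u|`: the induced map `Φ` of the sphere is conformal with
conformal factor `e^ω`. -/
theorem induced_sphere_map_is_conformal
    (n : ℕ) (hn : 1 ≤ n)
    (T : (Fin (n + 2) → ℝ) →ₗ[ℝ] (Fin (n + 2) → ℝ))
    (hT : ∀ v, mink (T v) (T v) = mink v v)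
    (hTnull : ∀ v, mink v v = 0 → 0 < v 0 → 0 < (T v) 0)
    (Φ : (Fin (n + 1) → ℝ) → (Fin (n + 1) → ℝ))
    (ω : (Fin (n + 1) → ℝ) → ℝ)
    (hΦω : ∀ y : Fin (n + 1) → ℝ, ∑ i, y i ^ 2 = 1 →
      T (pair 1 y) = Real.exp (-ω y) • pair 1 (Φ y))
    (x u : Fin (n + 1) → ℝ) (hx : ∑ i, x i ^ 2 = 1)
    (ε : ℝ) (hε : 0 < ε) (c : ℝ → (Fin (n + 1) → ℝ))
    (hc : ContDiffOn ℝ 1 c (Set.Ioo (-ε) ε))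
    (hcs : ∀ s ∈ Set.Ioo (-ε) ε, ∑ i, (c s i) ^ 2 = 1)
    (hc0 : c 0 = x) (hcu : deriv c 0 = u) :
    DifferentiableAt ℝ (fun s => Φ (c s)) 0 ∧
      Real.sqrt (∑ i, (deriv (fun s => Φ (c s)) 0 i) ^ 2) =
        Real.exp (ω x) * Real.sqrt (∑ i, u i ^ 2) := by
  have hmem : Set.Ioo (-ε) ε ∈ nhds (0 : ℝ) := Ioo_mem_nhds (by linarith) hε
  have hcd : HasDerivAt c u 0 :=
    hcu ▸ ((hc.contDiffAt hmem).differentiableAt one_ne_zero).hasDerivAt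
  have hF : HasDerivAt (fun s => T (pair 1 (c s))) (T (pair 0 u)) 0 :=
    T.toContinuousLinearMap.hasFDerivAt.comp_hasDerivAt 0 hcd.pair_one
  have hFi := hasDerivAt_pi.1 hF
  have htime : ∀ y : Fin (n + 1) → ℝ, ∑ i, y i ^ 2 = 1 → T (pair 1 y) 0 = Real.exp (-ω y) := by
    intro y hy
    rw [hΦω y hy]
    simp [pair]
  have hspace : ∀ y : Fin (n + 1) → ℝ, ∑ i, y i ^ 2 = 1 → ∀ i : Fin (n + 1),
      T (pair 1 y) i.succ = T (pair 1 y) 0 * Φ y i := by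
    intro y hy i
    rw [hΦω y hy]
    simp [pair]
  have hpos : T (pair 1 (c 0)) 0 ≠ 0 := by
    rw [htime _ (hc0 ▸ hx)]
    exact Real.exp_ne_zero _
  have hΦd : DifferentiableAt ℝ (fun s => Φ (c s)) 0 := by
    refine differentiableAt_pi.2 fun i => ?_
    refine ((hFi i.succ).div (hFi 0) hpos).differentiableAt.congr_of_eventuallyEq ?_
    filter_upwards [hmem] with s hs
    have hne : T (pair 1 (c s)) 0 ≠ 0 := by
      rw [htime _ (hcs s hs)]
      exact Real.exp_ne_zero _
    simp only [Pi.div_apply]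
    rw [hspace _ (hcs s hs) i, mul_div_cancel_left₀ _ hne]
  refine ⟨hΦd, ?_⟩
  have hv := hΦd.hasDerivAt
  set v := deriv (fun s => Φ (c s)) 0
  have hΦsphere : ∀ y : Fin (n + 1) → ℝ, ∑ i, y i ^ 2 = 1 → ∑ i, Φ y i ^ 2 = 1 := fun y hy =>
    sum_sq_eq_one_of_map_pair_eq_smul hT (Real.exp_ne_zero _) hy (hΦω y hy)
  have horth : ∑ i, Φ x i * v i = 0 := by
    have := hv.sum_mul_eq_zero_of_sum_sq_eq_one
      (by filter_upwards [hmem] with s hs using hΦsphere _ (hcs s hs))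
    simpa only [hc0] using this
  have hw : ∀ i : Fin (n + 1), T (pair 0 u) i.succ =
      T (pair 0 u) 0 * Φ x i + Real.exp (-ω x) * v i := by
    intro i
    have hprod := (hFi 0).mul (hasDerivAt_pi.1 hv i)
    have heq := (hFi i.succ).unique (hprod.congr_of_eventuallyEq
      (by filter_upwards [hmem] with s hs using hspace _ (hcs s hs) i))
    simpa only [hc0, htime x hx] using heq
  have hnorm : ∑ i, u i ^ 2 = Real.exp (-ω x) ^ 2 * ∑ i, v i ^ 2 := by
    have hiso := hT (pair 0 u)
    rw [mink_pair_self, mink] at hiso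
    have hexpand : ∑ i : Fin (n + 1), T (pair 0 u) i.succ * T (pair 0 u) i.succ =
        T (pair 0 u) 0 ^ 2 * ∑ i, Φ x i ^ 2 +
          2 * T (pair 0 u) 0 * Real.exp (-ω x) * ∑ i, Φ x i * v i +
          Real.exp (-ω x) ^ 2 * ∑ i, v i ^ 2 := by
      simp only [hw, Finset.mul_sum, ← Finset.sum_add_distrib]
      exact Finset.sum_congr rfl fun i _ => by ring
    rw [hexpand, hΦsphere x hx, horth] at hiso
    linarith
  rw [hnorm, Real.sqrt_mul (sq_nonneg _), Real.sqrt_sq (Real.exp_nonneg _), ← mul_assoc,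
    ← Real.exp_add, add_neg_cancel, Real.exp_zero, one_mul]
end

section
/- Let r > 0 and 1 ≤ k ≤ n-1. For x ∈ ℝᵏ, z ∈ ℝ^{n-k} with |z| < r, let φ(x,z) = ( √(|x|²+1+r²), x, z, √(r²-|z|²) ), η(x,z) = ( r√(|x|²+1+r²)/√(1+r²), rx/√(1+r²), √(1+r²)z/r, √(1+r²)√(r²-|z|²)/r ), and ψ = φ + η. Define ρ(x,z) = ln( (r+√(1+r²)) √(|x|²+1+r²) / √(1+r²) ) and G(x,z) = ( x/√(|x|²+1+r²), √(1+r²) z /(r√(|x|²+1+r²)), √(1+r²)√(r²-|z|²)/(r√(|x|²+1+r²)) ) ∈ ℝᵏ × ℝ^{n-k} × ℝ. Then ⟨ψ, ψ⟩ = 0, |G(x,z)| = 1, and ψ(x,z) = e^{ρ(x,z)} (1, G(x,z)). Hence e^ρ is the horospherical support function and G the hyperbolic Gauss map of the product example ℍᵏ(-1/(1+r²)) × 𝕊^{n-k}(1/r). -/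
open scoped BigOperators

/-- The Minkowski bilinear form on `ℝ^{n+2} = ℝ × ℝᵏ × ℝᵐ × ℝ` (with `m = n-k`),
written in block form: `⟨v, w⟩ = -v₀w₀ + Σ vᵢwᵢ`. -/
noncomputable def mink4 {k m : ℕ} (v w : ℝ × (Fin k → ℝ) × (Fin m → ℝ) × ℝ) : ℝ :=
  -(v.1 * w.1) + ∑ i, v.2.1 i * w.2.1 i + ∑ j, v.2.2.1 j * w.2.2.1 j +
    v.2.2.2 * w.2.2.2

/-- The parametrization `φ(x,z) = (√(|x|²+1+r²), x, z, √(r²-|z|²))` of the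
standard product `ℍᵏ(-1/(1+r²)) × 𝕊^{n-k}(1/r) ⊂ ℍ^{n+1}`. -/
noncomputable def phiProd {k m : ℕ} (r : ℝ) (x : Fin k → ℝ) (z : Fin m → ℝ) :
    ℝ × (Fin k → ℝ) × (Fin m → ℝ) × ℝ :=
  (Real.sqrt (∑ i, x i ^ 2 + 1 + r ^ 2), x, z, Real.sqrt (r ^ 2 - ∑ j, z j ^ 2))

/-- The unit normal field
`η(x,z) = (r√(|x|²+1+r²)/√(1+r²), rx/√(1+r²), √(1+r²)z/r, √(1+r²)√(r²-|z|²)/r)`. -/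
noncomputable def etaProd {k m : ℕ} (r : ℝ) (x : Fin k → ℝ) (z : Fin m → ℝ) :
    ℝ × (Fin k → ℝ) × (Fin m → ℝ) × ℝ :=
  (r * Real.sqrt (∑ i, x i ^ 2 + 1 + r ^ 2) / Real.sqrt (1 + r ^ 2),
    fun i => r * x i / Real.sqrt (1 + r ^ 2),
    fun j => Real.sqrt (1 + r ^ 2) * z j / r,
    Real.sqrt (1 + r ^ 2) * Real.sqrt (r ^ 2 - ∑ j, z j ^ 2) / r)

/-- The Minkowski square of a multiple of `(1, G)` is `c² (|G|² - 1)`. -/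
theorem mink4_smul_one_self {k m : ℕ} (c : ℝ) (u : Fin k → ℝ) (v : Fin m → ℝ) (w : ℝ) :
    mink4 (c • ((1 : ℝ), u, v, w)) (c • ((1 : ℝ), u, v, w)) =
      c ^ 2 * (∑ i, u i ^ 2 + ∑ j, v j ^ 2 + w ^ 2 - 1) := by
  have hsq {l : ℕ} (f : Fin l → ℝ) : ∑ i, c * f i * (c * f i) = c ^ 2 * ∑ i, f i ^ 2 := by
    rw [Finset.mul_sum]
    exact Finset.sum_congr rfl fun i _ => by ring
  simp only [mink4, Prod.smul_mk, Pi.smul_apply, smul_eq_mul, hsq]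
  ring

/-- with `ψ = φ + η`,
`ρ(x,z) = ln((r+√(1+r²))√(|x|²+1+r²)/√(1+r²))` and
`G(x,z) = (x/√(|x|²+1+r²), √(1+r²)z/(r√(|x|²+1+r²)), √(1+r²)√(r²-|z|²)/(r√(|x|²+1+r²)))`,
one has `⟨ψ,ψ⟩ = 0`, `|G| = 1`, and `ψ = e^ρ(1, G)`: `e^ρ` is the horospherical
support function and `G` the hyperbolic Gauss map of the product example
`ℍᵏ(-1/(1+r²)) × 𝕊^{n-k}(1/r)`. -/
theorem product_example_support_and_gauss
    (n k : ℕ) (hk : 1 ≤ k) (hkn : k ≤ n - 1) (r : ℝ) (hr : 0 < r)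
    (x : Fin k → ℝ) (z : Fin (n - k) → ℝ) (hz : ∑ j, z j ^ 2 < r ^ 2) :
    let ψ := phiProd (m := n - k) r x z + etaProd (m := n - k) r x z
    let a := Real.sqrt (∑ i, x i ^ 2 + 1 + r ^ 2)
    let ρ := Real.log ((r + Real.sqrt (1 + r ^ 2)) * a / Real.sqrt (1 + r ^ 2))
    let G1 : Fin k → ℝ := fun i => x i / a
    let G2 : Fin (n - k) → ℝ := fun j => Real.sqrt (1 + r ^ 2) * z j / (r * a)
    let G3 : ℝ := Real.sqrt (1 + r ^ 2) * Real.sqrt (r ^ 2 - ∑ j, z j ^ 2) / (r * a)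
    mink4 ψ ψ = 0 ∧ (∑ i, G1 i ^ 2) + (∑ j, G2 j ^ 2) + G3 ^ 2 = 1 ∧
      ψ = Real.exp ρ • ((1 : ℝ), G1, G2, G3) := by
  intro ψ a ρ G1 G2 G3
  have hx : 0 ≤ ∑ i, x i ^ 2 := Finset.sum_nonneg fun i _ => sq_nonneg (x i)
  have ha : 0 < a := Real.sqrt_pos.2 (by positivity)
  have ha2 : a ^ 2 = ∑ i, x i ^ 2 + 1 + r ^ 2 := Real.sq_sqrt (by positivity)
  have hs : 0 < √(1 + r ^ 2) := Real.sqrt_pos.2 (by positivity)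
  have hs2 : √(1 + r ^ 2) ^ 2 = 1 + r ^ 2 := Real.sq_sqrt (by positivity)
  have ht2 : √(r ^ 2 - ∑ j, z j ^ 2) ^ 2 = r ^ 2 - ∑ j, z j ^ 2 :=
    Real.sq_sqrt (sub_nonneg.2 hz.le)
  have hρ : Real.exp ρ = (r + √(1 + r ^ 2)) * a / √(1 + r ^ 2) :=
    Real.exp_log (by positivity)
  have hG : (∑ i, G1 i ^ 2) + (∑ j, G2 j ^ 2) + G3 ^ 2 = 1 := by
    simp only [G1, G2, G3, div_pow, mul_pow, ← Finset.sum_div, ← Finset.mul_sum, hs2, ht2]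
    field_simp
    rw [ha2]
    ring
  have hψ : ψ = Real.exp ρ • ((1 : ℝ), G1, G2, G3) := by
    rw [hρ]
    simp only [ψ, phiProd, etaProd, Prod.mk_add_mk, Prod.smul_mk, smul_eq_mul, Prod.mk.injEq]
    refine ⟨?_, funext fun i => ?_, funext fun j => ?_, ?_⟩
    · change a + r * a / √(1 + r ^ 2) = _
      field_simp
      ring
    · simp only [G1, Pi.add_apply, Pi.smul_apply, smul_eq_mul]
      field_simp
      ring
    · simp only [G2, Pi.add_apply, Pi.smul_apply, smul_eq_mul]
      field_simp
    · simp only [G3]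
      field_simp
  refine ⟨?_, hG, hψ⟩
  rw [hψ, mink4_smul_one_self, hG, sub_self, mul_zero]
end
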